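/- Let K ⊂ ℝ² be a compact t-Ahlfors regular set with t ∈ (0,2), and let s satisfy max{t−1, 0} < s ≤ 1. Then for a.e. e ∈ S¹, dimH({z ∈ K : the upper box dimension of K ∩ ℓ_{e,z} is ≥ s}) ≤ max{t−s, 0}. -/

import Mathlib

open MeasureTheory Metric Set
open scoped ENNReal NNReal

noncomputable section

/-- The Euclidean plane ℝ². -/
abbrev Plane := EuclideanSpace ℝ (Fin 2)

/-- The unit circle S¹ ⊆ ℝ². -/
def unitCircle : Set Plane := Metric.sphere (0 : Plane) 1

/-- The line `ℓ_{e,z} = z + span(e)` through `z` in direction `e`. -/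
def lineThrough (e z : Plane) : Set Plane := {w | ∃ r : ℝ, w = z + r • e}


/-- The standard (half-open) dyadic cube of side length `2^{-k}` indexed by `m : Fin d → ℤ`. -/
def dyadicCube (d k : ℕ) (m : Fin d → ℤ) : Set (EuclideanSpace ℝ (Fin d)) :=
  {x | ∀ i, (m i : ℝ) * (2 : ℝ) ^ (-(k : ℤ)) ≤ x i ∧
            x i < ((m i : ℝ) + 1) * (2 : ℝ) ^ (-(k : ℤ))}

/-- The dyadic `2^{-k}`-covering number `|P|_{2^{-k}}`: the number of standard dyadic cubes of
side length `2^{-k}` intersecting `P`. -/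
def covNum (d k : ℕ) (P : Set (EuclideanSpace ℝ (Fin d))) : ℕ :=
  Set.ncard {m : Fin d → ℤ | (dyadicCube d k m ∩ P).Nonempty}

/-- A bounded set `K ⊆ ℝ^d` is sub-uniformly distributed if there is `C > 0` with
`|K|_R · |K ∩ Q|_r ≤ C·|K|_r` for all dyadic scales `r = 2^{-k} ≤ R = 2^{-j}` and every dyadic
`R`-cube `Q` intersecting `K`. -/
def SubUniformlyDistributed {d : ℕ} (K : Set (EuclideanSpace ℝ (Fin d))) : Prop :=
  Bornology.IsBounded K ∧ ∃ C : ℝ, 0 < C ∧ ∀ j k : ℕ, j ≤ k → ∀ m : Fin d → ℤ,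
    (dyadicCube d j m ∩ K).Nonempty →
    (covNum d j K : ℝ) * (covNum d k (K ∩ dyadicCube d j m) : ℝ)
      ≤ C * (covNum d k K : ℝ)


/-- The lower box (Minkowski) dimension, computed along dyadic scales:
`liminf_{k→∞} log |A|_{2^{-k}} / log (2^k)`. -/
def lowerBoxDim {d : ℕ} (A : Set (EuclideanSpace ℝ (Fin d))) : ℝ :=
  Filter.liminf (fun k : ℕ => Real.log (covNum d k A) / ((k : ℝ) * Real.log 2)) Filter.atTop

/-- The upper box (Minkowski) dimension, computed along dyadic scales:
`limsup_{k→∞} log |A|_{2^{-k}} / log (2^k)`. -/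
def upperBoxDim {d : ℕ} (A : Set (EuclideanSpace ℝ (Fin d))) : ℝ :=
  Filter.limsup (fun k : ℕ => Real.log (covNum d k A) / ((k : ℝ) * Real.log 2)) Filter.atTop


/-- A compact set `K ⊆ ℝ^d` is `t`-Ahlfors regular: there are a Borel measure `μ` with support
`K` (here: `μ` vanishes outside `K` and obeys the lower bound on `K`) and constants
`0 < c ≤ C < ∞` such that `c·r^t ≤ μ(B(x,r)) ≤ C·r^t` for all `x ∈ K` and `0 < r ≤ diam K`. -/
def AhlforsRegular {d : ℕ} (t : ℝ) (K : Set (EuclideanSpace ℝ (Fin d))) : Prop :=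
  ∃ (μ : Measure (EuclideanSpace ℝ (Fin d))) (c C : ℝ), 0 < c ∧ c ≤ C ∧
    μ Kᶜ = 0 ∧
    ∀ x ∈ K, ∀ r : ℝ, 0 < r → r ≤ Metric.diam K →
      ENNReal.ofReal (c * r ^ t) ≤ μ (Metric.closedBall x r) ∧
      μ (Metric.closedBall x r) ≤ ENNReal.ofReal (C * r ^ t)

/-- projection along slope a -/
def pj (a : ℝ) (z : Plane) : ℝ := z 1 - a * z 0

def tube (a x r : ℝ) : Set Plane := {p | |pj a p - x| ≤ r}

def hk (δ R : ℝ) (u : ℝ) : ℝ :=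
  (Icc (-(2*δ)) (2*δ)).indicator (fun _ => 1/(4*δ)) u - (Icc (-R) R).indicator (fun _ => 1/(2*R)) u

def chi (A : ℝ) (a : ℝ) : ℝ := max 0 (A - |a|)

lemma pj_cont (a : ℝ) : Continuous (pj a) := by unfold pj; fun_prop

lemma tube_closed (a x r : ℝ) : IsClosed (tube a x r) := by
  unfold tube pj
  exact isClosed_le (by fun_prop) (by fun_prop)

lemma hk_meas (δ R : ℝ) : Measurable (hk δ R) := by
  unfold hk
  exact (measurable_const.indicator measurableSet_Icc).sub
    (measurable_const.indicator measurableSet_Icc)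

lemma hk_bd {δ R : ℝ} (hδ : 0 < δ) (hR : 2 * δ ≤ R) (u : ℝ) : |hk δ R u| ≤ 1/δ := by
  unfold hk
  have h1 : 0 < 1/(4*δ) := by positivity
  have hRp : 0 < R := by linarith
  have h2 : 0 < 1/(2*R) := by positivity
  have h3 : 1/(2*R) ≤ 1/δ := by
    apply one_div_le_one_div_of_le hδ; linarith
  have h4 : 1/(4*δ) ≤ 1/δ := by
    apply one_div_le_one_div_of_le hδ; linarith
  simp only [indicator]
  rw [abs_le]
  split_ifs <;> constructor <;> linarith

lemma hk_zero {δ R : ℝ} (hR : 2 * δ ≤ R) {u : ℝ} (hu : R < |u|) : hk δ R u = 0 := by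
  unfold hk
  have h1 : u ∉ Icc (-R) R := fun h => by
    rw [mem_Icc, ← abs_le] at h; linarith
  have h2 : u ∉ Icc (-(2*δ)) (2*δ) := fun h => by
    rw [mem_Icc, ← abs_le] at h; linarith
  simp [indicator, h1, h2]

lemma hk_int (δ R : ℝ) : Integrable (hk δ R) := by
  unfold hk
  refine Integrable.sub ?_ ?_ <;>
  · rw [integrable_indicator_iff measurableSet_Icc]
    exact integrableOn_const (by simp)

lemma hk_mean {δ R : ℝ} (hδ : 0 < δ) (hR : 2 * δ ≤ R) : ∫ u, hk δ R u = 0 := by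
  unfold hk
  have hRp : 0 < R := by linarith
  rw [integral_sub]
  · rw [integral_indicator_const _ measurableSet_Icc, integral_indicator_const _ measurableSet_Icc]
    simp only [Measure.real, Real.volume_Icc, smul_eq_mul]
    rw [ENNReal.toReal_ofReal (by linarith), ENNReal.toReal_ofReal (by linarith)]
    field_simp; ring
  all_goals
    rw [integrable_indicator_iff measurableSet_Icc]
    exact integrableOn_const (by simp)

lemma hk_l1 {δ R : ℝ} (hδ : 0 < δ) (hR : 2 * δ ≤ R) : ∫ u, |hk δ R u| ≤ 2 := by
  have hRp : 0 < R := by linarith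
  have i1 : Integrable ((Icc (-(2*δ)) (2*δ)).indicator (fun _ : ℝ => 1/(4*δ))) := by
    rw [integrable_indicator_iff measurableSet_Icc]
    exact integrableOn_const (by simp)
  have i2 : Integrable ((Icc (-R) R).indicator (fun _ : ℝ => 1/(2*R))) := by
    rw [integrable_indicator_iff measurableSet_Icc]
    exact integrableOn_const (by simp)
  calc ∫ u, |hk δ R u| ≤ ∫ u, ((Icc (-(2*δ)) (2*δ)).indicator (fun _ => 1/(4*δ)) u
        + (Icc (-R) R).indicator (fun _ => 1/(2*R)) u) := by
        refine integral_mono (hk_int δ R).abs (i1.add i2) ?_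
        intro u
        refine (abs_sub _ _).trans (le_of_eq ?_)
        rw [abs_of_nonneg, abs_of_nonneg] <;> apply indicator_nonneg <;> intros <;> positivity
    _ = 2 := by
      rw [integral_add i1 i2]
      rw [integral_indicator_const _ measurableSet_Icc, integral_indicator_const _ measurableSet_Icc]
      simp only [Measure.real, Real.volume_Icc, smul_eq_mul]
      rw [ENNReal.toReal_ofReal (by linarith), ENNReal.toReal_ofReal (by linarith)]
      field_simp; norm_num

lemma chi_nonneg (A a : ℝ) : 0 ≤ chi A a := le_max_left _ _

lemma chi_le {A : ℝ} (hA : 0 ≤ A) (a : ℝ) : chi A a ≤ A :=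
  max_le hA (by linarith [abs_nonneg a])

lemma chi_cont (A : ℝ) : Continuous (chi A) := by unfold chi; fun_prop

lemma chi_zero {A a : ℝ} (h : A ≤ |a|) : chi A a = 0 := by
  unfold chi; exact max_eq_left (by linarith)

lemma chi_pos {A a : ℝ} (h : |a| < A) : 0 < chi A a := by
  unfold chi; exact lt_max_of_lt_right (by linarith)

lemma chi_lip (A a b : ℝ) : |chi A a - chi A b| ≤ |a - b| := by
  unfold chi
  have h := abs_max_sub_max_le_abs (A - |a|) (A - |b|) 0
  rw [max_comm 0, max_comm 0]
  refine h.trans ?_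
  rw [show A - |a| - (A - |b|) = |b| - |a| by ring, abs_sub_comm a b]
  exact abs_abs_sub_abs_le b a

lemma inner_bd {δ R A : ℝ} (hδ : 0 < δ) (hR : 2 * δ ≤ R) (u v0 v1 : ℝ) (hv : v0 ≠ 0) :
    |∫ a, chi A a * hk δ R (u - (v1 - a * v0))| ≤ 2 * R / v0^2 := by
  have hRp : 0 < R := by linarith
  set G : ℝ → ℝ := fun b => chi A ((b - (u - v1)) / v0) * hk δ R b with hG
  have e1 : ∫ a, chi A a * hk δ R (u - (v1 - a * v0)) = |v0⁻¹| * ∫ b, G b := by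
    have := Measure.integral_comp_mul_left (fun b => G (b + (u - v1))) v0
    rw [integral_add_right_eq_self G] at this
    rw [smul_eq_mul] at this
    rw [← this]
    congr 1; ext a
    simp only [hG]
    congr 2
    · field_simp; ring
    · ring
  have iG : Integrable G := by
    refine (hk_int δ R).bdd_mul (c := |A|) ?_ ?_
    · exact ((chi_cont A).comp (by fun_prop)).aestronglyMeasurable
    · refine Filter.Eventually.of_forall fun b => ?_
      rw [Real.norm_of_nonneg (chi_nonneg _ _)]
      exact max_le (abs_nonneg _) (by linarith [le_abs_self A, abs_nonneg ((b - (u - v1)) / v0)])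
  have e2 : ∫ b, G b = ∫ b, (G b - chi A (-(u - v1) / v0) * hk δ R b) := by
    rw [integral_sub iG ((hk_int δ R).const_mul _), integral_const_mul, hk_mean hδ hR]; simp
  have e3 : |∫ b, G b| ≤ R / |v0| * 2 := by
    rw [e2]
    calc |∫ b, (G b - chi A (-(u - v1) / v0) * hk δ R b)|
        ≤ ∫ b, |G b - chi A (-(u - v1) / v0) * hk δ R b| := abs_integral_le_integral_abs
      _ ≤ ∫ b, R / |v0| * |hk δ R b| := by
        refine integral_mono (iG.sub ((hk_int δ R).const_mul _)).abs
          ((hk_int δ R).abs.const_mul _) ?_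
        intro b
        simp only [hG]
        rw [← sub_mul, abs_mul]
        by_cases hb : R < |b|
        · rw [hk_zero hR hb]; simp
        · refine mul_le_mul_of_nonneg_right ?_ (abs_nonneg _)
          refine (chi_lip _ _ _).trans ?_
          rw [show (b - (u - v1)) / v0 - -(u - v1) / v0 = b / v0 by ring, abs_div]
          gcongr; exact not_lt.mp hb
      _ ≤ R / |v0| * 2 := by
        rw [integral_const_mul]
        gcongr
        exact hk_l1 hδ hR
  rw [e1, abs_mul, abs_abs, abs_inv]
  have hv' : 0 < |v0| := abs_pos.mpr hv
  calc |v0|⁻¹ * |∫ b, G b| ≤ |v0|⁻¹ * (R / |v0| * 2) := by gcongr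
    _ = 2 * R / v0^2 := by rw [← sq_abs v0]; field_simp

def Fk (A δ R : ℝ) (p : ℝ × ℝ) (q : Plane × Plane) : ℝ :=
  chi A p.1 * (hk δ R (pj p.1 q.1 - p.2) * hk δ R (pj p.1 q.2 - p.2))

lemma Fk_meas (A δ R : ℝ) : Measurable (Function.uncurry (Fk A δ R)) := by
  unfold Function.uncurry Fk pj
  have h1 := (chi_cont A).measurable
  have h2 := hk_meas δ R
  refine (h1.comp (by fun_prop)).mul ((h2.comp ?_).mul (h2.comp ?_)) <;> fun_prop

lemma Fk_bd {A δ R : ℝ} (hA : 0 ≤ A) (hδ : 0 < δ) (hR : 2 * δ ≤ R) (p : ℝ × ℝ) (q : Plane × Plane) :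
    ‖Fk A δ R p q‖ ≤ A * (1/δ * (1/δ)) := by
  unfold Fk
  rw [norm_mul, norm_mul, Real.norm_of_nonneg (chi_nonneg _ _)]
  gcongr
  · exact chi_le hA _
  · exact hk_bd hδ hR _
  · exact hk_bd hδ hR _

lemma pj_sub (a : ℝ) (z w : Plane) : pj a (z - w) = pj a z - pj a w := by
  unfold pj; simp; ring

lemma pair_eq {A δ R M : ℝ} (hA : 0 ≤ A) (hδ : 0 < δ) (hR : 2 * δ ≤ R) (z w : Plane)
    (hz : ∀ a, |a| ≤ A → |pj a z| + R ≤ M) :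
    ∫ p, Fk A δ R p (z, w) ∂((volume.restrict (Icc (-A) A)).prod (volume.restrict (Icc (-M) M)))
      = ∫ u, hk δ R u * ∫ a, chi A a * hk δ R (u - pj a (z - w)) := by
  have hm : Measurable (fun p => Fk A δ R p (z, w)) :=
    (Fk_meas A δ R).comp (measurable_id.prodMk measurable_const)
  rw [integral_prod]
  swap
  · refine Integrable.of_bound hm.aestronglyMeasurable (A * (1/δ * (1/δ))) ?_
    exact Filter.Eventually.of_forall fun p => Fk_bd hA hδ hR _ _
  have e1 : ∀ a ∈ Icc (-A) A, ∫ x in Icc (-M) M, Fk A δ R (a, x) (z, w)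
      = ∫ u, chi A a * (hk δ R u * hk δ R (u - pj a (z - w))) := by
    intro a ha
    rw [mem_Icc, ← abs_le] at ha
    rw [setIntegral_eq_integral_of_forall_compl_eq_zero]
    · rw [← integral_sub_left_eq_self
        (fun u => chi A a * (hk δ R u * hk δ R (u - pj a (z - w)))) volume (pj a z)]
      congr 1; ext x
      simp only [Fk]
      congr 3
      rw [pj_sub]; ring
    · intro x hx
      simp only [Fk]
      rw [hk_zero hR]
      · simp
      · rw [mem_Icc, ← abs_le, not_le] at hx
        have := hz a ha
        have h3 : |x| ≤ |pj a z| + |pj a z - x| := by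
          have := abs_sub (pj a z) (pj a z - x)
          simpa using this
        linarith
  rw [setIntegral_congr_fun measurableSet_Icc e1]
  rw [integral_integral_swap]
  · congr 1; ext u
    rw [setIntegral_eq_integral_of_forall_compl_eq_zero]
    · rw [← integral_const_mul]
      congr 1; ext a; ring
    · intro a ha
      rw [mem_Icc, ← abs_le, not_le] at ha
      rw [chi_zero ha.le]; simp
  · have : Integrable (fun p : ℝ × ℝ => (1:ℝ) * hk δ R p.2)
      ((volume.restrict (Icc (-A) A)).prod volume) :=
      Integrable.mul_prod (integrable_const _) (hk_int δ R)
    have h2 := this.bdd_mul (c := A * (1/δ)) (f := fun p : ℝ × ℝ => chi A p.1 * hk δ R (p.2 - pj p.1 (z - w))) ?_ ?_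
    · refine h2.congr (Filter.Eventually.of_forall fun p => ?_)
      simp only [Function.uncurry]; ring
    · have h1 := (chi_cont A).measurable
      have h2 := hk_meas δ R
      unfold pj
      refine ((h1.comp (by fun_prop)).mul (h2.comp ?_)).aestronglyMeasurable
      fun_prop
    · refine Filter.Eventually.of_forall fun p => ?_
      rw [norm_mul, Real.norm_of_nonneg (chi_nonneg _ _)]
      gcongr
      · exact chi_le hA _
      · exact hk_bd hδ hR _

lemma norm_le_coord (v : Plane) : ‖v‖ ≤ |v 0| + |v 1| := by
  rw [EuclideanSpace.norm_eq]
  simp only [Fin.sum_univ_two, Real.norm_eq_abs]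
  rw [Real.sqrt_le_left (by positivity)]
  nlinarith [abs_nonneg (v 0), abs_nonneg (v 1)]

lemma coord_le_norm (v : Plane) (i : Fin 2) : |v i| ≤ ‖v‖ := by
  simpa using PiLp.norm_apply_le v i

lemma pair_of_inner {δ R B : ℝ} (hδ : 0 < δ) (hR : 2 * δ ≤ R) (hB : 0 ≤ B)
    (f : ℝ → ℝ) (hf : ∀ u, |u| ≤ R → |f u| ≤ B) :
    |∫ u, hk δ R u * f u| ≤ 2 * B := by
  calc |∫ u, hk δ R u * f u| ≤ ∫ u, |hk δ R u| * B := by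
        rw [← Real.norm_eq_abs]
        refine norm_integral_le_of_norm_le ((hk_int δ R).abs.mul_const _) ?_
        refine Filter.Eventually.of_forall fun u => ?_
        rw [norm_mul, Real.norm_eq_abs, Real.norm_eq_abs]
        by_cases h : |u| ≤ R
        · gcongr; exact hf u h
        · rw [hk_zero hR (not_le.mp h)]; simp
    _ ≤ 2 * B := by
        rw [integral_mul_const]; gcongr; exact hk_l1 hδ hR

lemma pair_near {A δ R : ℝ} (hA : 0 ≤ A) (hδ : 0 < δ) (hR : 2 * δ ≤ R) (v : Plane) :
    |∫ u, hk δ R u * ∫ a, chi A a * hk δ R (u - pj a v)| ≤ 4 * A^2 * (1/δ) := by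
  have : 4 * A^2 * (1/δ) = 2 * (A * (1/δ) * (2 * A)) := by ring
  rw [this]
  refine pair_of_inner hδ hR (by positivity) _ ?_
  intro u _
  rw [← setIntegral_eq_integral_of_forall_compl_eq_zero (s := Icc (-A) A), ← Real.norm_eq_abs]
  · have := norm_setIntegral_le_of_norm_le_const (μ := volume) (s := Icc (-A) A)
      (f := fun a => chi A a * hk δ R (u - pj a v)) (C := A * (1/δ)) (by simp) (fun a _ => by
      rw [norm_mul, Real.norm_of_nonneg (chi_nonneg _ _)]
      gcongr
      · exact chi_le hA _
      · exact hk_bd hδ hR _)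
    refine this.trans (le_of_eq ?_)
    simp only [Measure.real, Real.volume_Icc]
    rw [ENNReal.toReal_ofReal (by linarith)]; ring
  · intro a ha
    rw [mem_Icc, ← abs_le, not_le] at ha
    rw [chi_zero ha.le]; simp

lemma pair_far {A δ R : ℝ} (hA : 0 ≤ A) (hδ : 0 < δ) (hR : 2 * δ ≤ R) (v : Plane)
    (hv : 4 * R ≤ ‖v‖) :
    |∫ u, hk δ R u * ∫ a, chi A a * hk δ R (u - pj a v)| ≤ 16 * (A+1)^2 * R / ‖v‖^2 := by
  have hRp : 0 < R := by linarith
  have hvp : 0 < ‖v‖ := by linarith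
  have : 16 * (A+1)^2 * R / ‖v‖^2 = 2 * (8 * (A+1)^2 * R / ‖v‖^2) := by ring
  rw [this]
  refine pair_of_inner hδ hR (by positivity) _ ?_
  intro u hu
  by_cases hc : A * |v 0| + 2 * R < |v 1|
  · have : ∀ a, chi A a * hk δ R (u - pj a v) = 0 := by
      intro a
      by_cases ha : A ≤ |a|
      · rw [chi_zero ha]; simp
      · push Not at ha
        rw [hk_zero hR]; · simp
        unfold pj
        have h1 : |a * v 0| ≤ A * |v 0| := by rw [abs_mul]; gcongr
        have h2 : |v 1| ≤ |u - (v 1 - a * v 0)| + |u| + |a * v 0| := by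
          have := abs_add_three (-(u - (v 1 - a * v 0))) u (a * v 0)
          rw [abs_neg] at this
          refine le_trans (le_of_eq ?_) this
          congr 1; ring
        linarith
    simp only [this, integral_zero, abs_zero]
    positivity
  · push Not at hc
    have h1 : ‖v‖ ≤ 2 * (A + 1) * |v 0| := by
      have := norm_le_coord v
      nlinarith
    have hv0 : 0 < |v 0| := by
      by_contra h
      have : |v 0| = 0 := le_antisymm (not_lt.mp h) (abs_nonneg _)
      rw [this] at h1; linarith
    have := inner_bd (A := A) hδ hR u (v 0) (v 1) (abs_pos.mp hv0)
    refine this.trans ?_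
    rw [div_le_div_iff₀ (by rw [← sq_abs]; positivity) (by positivity)]
    have h2 : ‖v‖^2 ≤ (2 * (A + 1) * |v 0|)^2 := by gcongr
    rw [mul_pow, sq_abs] at h2
    nlinarith

def gk (μ : Measure Plane) (δ R : ℝ) (p : ℝ × ℝ) : ℝ := ∫ z, hk δ R (pj p.1 z - p.2) ∂μ

lemma gk_meas (μ : Measure Plane) [IsFiniteMeasure μ] (δ R : ℝ) : Measurable (gk μ δ R) := by
  unfold gk
  have : StronglyMeasurable (fun q : (ℝ × ℝ) × Plane => hk δ R (pj q.1.1 q.2 - q.1.2)) := by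
    apply Measurable.stronglyMeasurable
    refine (hk_meas δ R).comp ?_
    unfold pj; fun_prop
  exact this.integral_prod_right.measurable

lemma ann {R v : ℝ} (hR : 0 < R) (hv : 4 * R ≤ v) :
    ∃ j : ℕ, 4 * 2^j * R ≤ v ∧ v ≤ 2^(j+3) * R := by
  obtain ⟨j, h1, h2⟩ := exists_nat_pow_near (x := v / (4 * R)) (y := 2)
    (by rw [le_div_iff₀ (by positivity)]; linarith) (by norm_num)
  refine ⟨j, ?_, ?_⟩
  · rw [le_div_iff₀ (by positivity)] at h1; linarith
  · rw [div_lt_iff₀ (by positivity)] at h2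
    rw [pow_succ] at h2
    rw [pow_add]; nlinarith

lemma pair_series {A δ R N : ℝ} (hA : 0 ≤ A) (hδ : 0 < δ) (hN : 2 ≤ N) (hRN : R = N * δ)
    (z w : Plane) :
    ‖∫ u, hk δ R u * ∫ a, chi A a * hk δ R (u - pj a (z - w))‖ₑ ≤
      ∑' j : ℕ, ({q : Plane × Plane | dist q.2 q.1 ≤ 2^(j+3) * R}.indicator
        (fun _ => ENNReal.ofReal (4 * (A+1)^2 * N / R * (1/4)^j)) (z, w)) := by
  have hR : 2 * δ ≤ R := by rw [hRN]; gcongr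
  have hRp : 0 < R := by linarith
  have key : ∃ j : ℕ, dist w z ≤ 2^(j+3) * R ∧
      |∫ u, hk δ R u * ∫ a, chi A a * hk δ R (u - pj a (z - w))| ≤ 4 * (A+1)^2 * N / R * (1/4)^j := by
    by_cases hv : 4 * R ≤ ‖z - w‖
    · obtain ⟨j, h1, h2⟩ := ann hRp hv
      refine ⟨j, by rwa [dist_comm, dist_eq_norm], ?_⟩
      refine (pair_far hA hδ hR _ hv).trans ?_
      have h3 : 0 < 4 * 2^j * R := by positivity
      calc 16 * (A+1)^2 * R / ‖z - w‖^2 ≤ 16 * (A+1)^2 * R / (4 * 2^j * R)^2 := by gcongr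
        _ = (A+1)^2 / R * (1/4)^j := by
          rw [mul_pow, mul_pow, ← pow_mul, mul_comm j 2, pow_mul]; norm_num
          field_simp
          rw [← mul_pow]; norm_num
        _ ≤ 4 * (A+1)^2 * N / R * (1/4)^j := by
          gcongr
          nlinarith [sq_nonneg (A+1)]
    · refine ⟨0, ?_, ?_⟩
      · rw [dist_comm, dist_eq_norm]; norm_num; linarith
      · refine (pair_near hA hδ hR _).trans ?_
        have : 1/δ = N / R := by rw [hRN]; field_simp
        rw [this, pow_zero, mul_one, mul_div_assoc]
        have h1 : A^2 ≤ (A+1)^2 := by gcongr; linarith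
        gcongr
  obtain ⟨j, h1, h2⟩ := key
  refine le_trans ?_ (ENNReal.le_tsum j)
  rw [indicator_of_mem (by exact h1), Real.enorm_eq_ofReal_abs]
  exact ENNReal.ofReal_le_ofReal h2

lemma energy (μ : Measure Plane) [IsFiniteMeasure μ] (K : Set Plane) (hKc : μ Kᶜ = 0)
    {t C A N : ℝ} (hC : 0 ≤ C) (ht2 : t < 2) (hA : 0 ≤ A) (hN : 2 ≤ N)
    (hup : ∀ x ∈ K, ∀ r : ℝ, 0 < r → μ (closedBall x r) ≤ ENNReal.ofReal (C * r ^ t)) :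
    ∃ D : ℝ, 0 ≤ D ∧ ∀ δ R M : ℝ, 0 < δ → R = N * δ →
      (∀ z ∈ K, ∀ a, |a| ≤ A → |pj a z| + R ≤ M) →
      ∫⁻ p, ENNReal.ofReal (chi A p.1 * (gk μ δ R p)^2)
        ∂((volume.restrict (Icc (-A) A)).prod (volume.restrict (Icc (-M) M))) ≤
      ENNReal.ofReal (D * δ ^ (t - 1)) := by
  have hK : ∀ᵐ z ∂μ, z ∈ K := by rw [ae_iff]; exact hKc
  have hrat : (2:ℝ)^(t-2) < 1 := Real.rpow_lt_one_of_one_lt_of_neg (by norm_num) (by linarith)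
  have hrat0 : 0 < (2:ℝ)^(t-2) := by positivity
  set D0 : ℝ := 4 * (A+1)^2 * N * C * 8^t * (1 - (2:ℝ)^(t-2))⁻¹ with hD0
  have hD0' : 0 ≤ D0 := by
    have : 0 < 1 - (2:ℝ)^(t-2) := by linarith
    positivity
  refine ⟨D0 * N^(t-1) * μ.real univ, by positivity, ?_⟩
  intro δ R M hδ hRN hM
  have hR : 2 * δ ≤ R := by rw [hRN]; gcongr
  have hRp : 0 < R := by linarith
  set P := (volume.restrict (Icc (-A) A)).prod (volume.restrict (Icc (-M) M)) with hP
  have iF : Integrable (Function.uncurry (Fk A δ R)) (P.prod (μ.prod μ)) := by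
    refine Integrable.of_bound (Fk_meas A δ R).aestronglyMeasurable (A * (1/δ * (1/δ))) ?_
    exact Filter.Eventually.of_forall fun p => Fk_bd hA hδ hR _ _
  have e1 : ∀ p, chi A p.1 * (gk μ δ R p)^2 = ∫ q, Fk A δ R p q ∂(μ.prod μ) := by
    intro p
    simp only [Fk]
    rw [integral_const_mul, integral_prod_mul (fun z => hk δ R (pj p.1 z - p.2))
      (fun z => hk δ R (pj p.1 z - p.2)), sq]
    rfl
  have i1 : Integrable (fun p => chi A p.1 * (gk μ δ R p)^2) P := by
    simp only [e1]
    exact iF.integral_prod_left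
  rw [← ofReal_integral_eq_lintegral_ofReal i1
    (Filter.Eventually.of_forall fun p => mul_nonneg (chi_nonneg _ _) (sq_nonneg _))]
  simp only [e1]
  rw [integral_integral_swap iF]
  have msets : ∀ j : ℕ, MeasurableSet {q : Plane × Plane | dist q.2 q.1 ≤ 2^(j+3) * R} := by
    intro j
    apply IsClosed.measurableSet
    exact isClosed_le (by fun_prop) (by fun_prop)
  have hK2 : ∀ᵐ q ∂(μ.prod μ), q.1 ∈ K := by
    exact Measure.quasiMeasurePreserving_fst.ae hK
  have hterm : ∀ z ∈ K, ∀ j : ℕ, ∫⁻ w, ({q : Plane × Plane | dist q.2 q.1 ≤ 2^(j+3) * R}.indicator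
        (fun _ => ENNReal.ofReal (4 * (A+1)^2 * N / R * (1/4)^j)) (z, w)) ∂μ ≤
        ENNReal.ofReal (4 * (A+1)^2 * N * C * 8^t * R^(t-1) * ((2:ℝ)^(t-2))^j) := by
    intro z hz j
    have : ∀ w, ({q : Plane × Plane | dist q.2 q.1 ≤ 2^(j+3) * R}.indicator
        (fun _ => ENNReal.ofReal (4 * (A+1)^2 * N / R * (1/4)^j)) (z, w)) =
        (closedBall z (2^(j+3) * R)).indicator
        (fun _ => ENNReal.ofReal (4 * (A+1)^2 * N / R * (1/4)^j)) w := by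
      intro w; rfl
    simp only [this]
    rw [lintegral_indicator_const measurableSet_closedBall]
    refine (mul_le_mul_right (hup z hz _ (by positivity)) _).trans ?_
    rw [← ENNReal.ofReal_mul (by positivity)]
    apply ENNReal.ofReal_le_ofReal
    apply le_of_eq
    rw [Real.mul_rpow (by positivity) hRp.le, pow_add,
      Real.mul_rpow (by positivity) (by positivity), Real.rpow_sub hRp, Real.rpow_one,
      Real.rpow_sub (by norm_num), ← Real.rpow_natCast_mul (by norm_num), mul_comm (j:ℝ) t,
      Real.rpow_mul_natCast (by norm_num), div_pow]
    norm_num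
    rw [div_pow (2 ^ t) 4 j]
    field_simp
  calc ENNReal.ofReal (∫ q, ∫ p, Fk A δ R p q ∂P ∂(μ.prod μ))
      ≤ ‖∫ q, ∫ p, Fk A δ R p q ∂P ∂(μ.prod μ)‖ₑ := by
        rw [Real.enorm_eq_ofReal_abs]; exact ENNReal.ofReal_le_ofReal (le_abs_self _)
    _ ≤ ∫⁻ q, ‖∫ p, Fk A δ R p q ∂P‖ₑ ∂(μ.prod μ) := enorm_integral_le_lintegral_enorm _
    _ ≤ ∫⁻ q, ∑' j : ℕ, ({q : Plane × Plane | dist q.2 q.1 ≤ 2^(j+3) * R}.indicator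
        (fun _ => ENNReal.ofReal (4 * (A+1)^2 * N / R * (1/4)^j)) q) ∂(μ.prod μ) := by
        refine lintegral_mono_ae ?_
        filter_upwards [hK2] with q hq
        obtain ⟨z, w⟩ := q
        rw [hP, pair_eq hA hδ hR z w (hM z hq)]
        exact pair_series hA hδ hN hRN z w
    _ = ∫⁻ z, ∫⁻ w, ∑' j : ℕ, ({q : Plane × Plane | dist q.2 q.1 ≤ 2^(j+3) * R}.indicator
        (fun _ => ENNReal.ofReal (4 * (A+1)^2 * N / R * (1/4)^j)) (z, w)) ∂μ ∂μ := by
        rw [lintegral_prod]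
        apply Measurable.aemeasurable
        exact Measurable.tsum fun j => measurable_const.indicator (msets j)
    _ ≤ ∫⁻ z, ENNReal.ofReal (D0 * R^(t-1)) ∂μ := by
        refine lintegral_mono_ae ?_
        filter_upwards [hK] with z hz
        rw [lintegral_tsum]
        · refine (ENNReal.tsum_le_tsum (hterm z hz)).trans (le_of_eq ?_)
          rw [← ENNReal.ofReal_tsum_of_nonneg (fun j => by positivity)
            ((summable_geometric_of_lt_one hrat0.le hrat).mul_left _),
            tsum_mul_left, tsum_geometric_of_lt_one hrat0.le hrat]
          congr 1; rw [hD0]; ring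
        · intro j
          apply Measurable.aemeasurable
          exact (measurable_const.indicator (msets j)).comp (measurable_const.prodMk measurable_id)
    _ = ENNReal.ofReal (D0 * N^(t-1) * μ.real univ * δ^(t-1)) := by
        rw [lintegral_const, ← ofReal_measureReal, ← ENNReal.ofReal_mul (by positivity), hRN,
          Real.mul_rpow (by positivity) hδ.le]
        congr 1; ring

lemma cube_floor {k : ℕ} {m : Fin 2 → ℤ} {z : Plane} (hz : z ∈ dyadicCube 2 k m) (i : Fin 2) :
    ⌊z i * 2^k⌋ = m i := by
  have h := hz i
  have hp : (0:ℝ) < 2^k := by positivity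
  rw [zpow_neg, zpow_natCast, ← div_eq_mul_inv, ← div_eq_mul_inv, div_le_iff₀ hp,
    lt_div_iff₀ hp] at h
  rw [Int.floor_eq_iff]; exact h

lemma packing (μ : Measure Plane) (k : ℕ) (S : Finset (Fin 2 → ℤ)) (z : (Fin 2 → ℤ) → Plane)
    (hz : ∀ m ∈ S, z m ∈ dyadicCube 2 k m) (r : ℝ) (hr : r ≤ (1/2)^k) (b : ℝ≥0∞)
    (hb : ∀ m ∈ S, b ≤ μ (closedBall (z m) r)) (U : Set Plane) (hU : MeasurableSet U)
    (hsub : ∀ m ∈ S, closedBall (z m) r ⊆ U) : (S.card : ℝ≥0∞) * b ≤ 9 * μ U := by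
  classical
  have hp : (0:ℝ) < 2^k := by positivity
  calc (S.card : ℝ≥0∞) * b = ∑ m ∈ S, b := by simp
    _ ≤ ∑ m ∈ S, μ (closedBall (z m) r) := Finset.sum_le_sum hb
    _ = ∑ m ∈ S, ∫⁻ y, (closedBall (z m) r).indicator (fun _ => 1) y ∂μ := by
        refine Finset.sum_congr rfl fun m _ => ?_
        rw [lintegral_indicator_const measurableSet_closedBall, one_mul]
    _ = ∫⁻ y, ∑ m ∈ S, (closedBall (z m) r).indicator (fun _ => 1) y ∂μ := by
        rw [lintegral_finsetSum]
        exact fun m _ => measurable_const.indicator measurableSet_closedBall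
    _ ≤ ∫⁻ y, U.indicator (fun _ => 9) y ∂μ := by
        refine lintegral_mono fun y => ?_
        by_cases hy : y ∈ U
        · rw [indicator_of_mem hy]
          have e : ∑ m ∈ S, (closedBall (z m) r).indicator (fun _ => (1:ℝ≥0∞)) y
              = ((S.filter (fun m => y ∈ closedBall (z m) r)).card : ℝ≥0∞) := by
            simp [indicator]
          rw [e]
          set f : Fin 2 → ℤ := fun i => ⌊y i * 2^k⌋
          have hsubs : S.filter (fun m => y ∈ closedBall (z m) r) ⊆ Finset.Icc (f - 1) (f + 1) := by
            intro m hm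
            rw [Finset.mem_filter] at hm
            obtain ⟨hmS, hym⟩ := hm
            rw [mem_closedBall, dist_eq_norm] at hym
            have hc : ∀ i, f i - 1 ≤ m i ∧ m i ≤ f i + 1 := by
              intro i
              have h1 := (coord_le_norm (y - z m) i).trans (hym.trans hr)
              rw [PiLp.sub_apply, abs_le] at h1
              have hfl := cube_floor (hz m hmS) i
              have h2 : (1/2:ℝ)^k * 2^k = 1 := by rw [← mul_pow]; norm_num
              have h3 : y i * 2^k ≤ z m i * 2^k + 1 := by nlinarith
              have h4 : z m i * 2^k ≤ y i * 2^k + 1 := by nlinarith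
              have h5 := Int.floor_mono h3
              have h6 := Int.floor_mono h4
              rw [Int.floor_add_one] at h5 h6
              rw [hfl] at h5 h6
              constructor
              · simp only [f]; linarith
              · simp only [f]; linarith
            rw [Finset.mem_Icc]
            exact ⟨fun i => (hc i).1, fun i => (hc i).2⟩
          have hcard := Finset.card_le_card hsubs
          rw [Pi.card_Icc] at hcard
          simp only [Fin.prod_univ_two, Int.card_Icc, Pi.sub_apply, Pi.add_apply, Pi.one_apply] at hcard
          have h9 : ∀ i : ℤ, (i + 1 + 1 - (i - 1)).toNat = 3 := by intro i; omega
          rw [h9, h9] at hcard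
          have h33 : 3 * 3 = 9 := rfl
          rw [h33] at hcard
          exact (Nat.cast_le (α := ℝ≥0∞).mpr hcard).trans (by norm_num)
        · rw [indicator_of_notMem hy]
          rw [nonpos_iff_eq_zero]
          refine Finset.sum_eq_zero fun m hm => ?_
          rw [indicator_of_notMem]
          exact fun h => hy (hsub m hm h)
    _ = 9 * μ U := by rw [lintegral_indicator_const hU]

lemma pj_dist {A a : ℝ} (ha : |a| ≤ A) (p z : Plane) : |pj a p - pj a z| ≤ (1 + A) * dist p z := by
  rw [← pj_sub, dist_eq_norm]
  set v := p - z
  unfold pj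
  have h0 := coord_le_norm v 0
  have h1 := coord_le_norm v 1
  have hA := (abs_nonneg a).trans ha
  calc |v 1 - a * v 0| ≤ |v 1| + |a * v 0| := abs_sub _ _
    _ = |v 1| + |a| * |v 0| := by rw [abs_mul]
    _ ≤ ‖v‖ + A * ‖v‖ := by gcongr
    _ = _ := by ring

lemma ball_tube {A a x δ : ℝ} (ha : |a| ≤ A) (z : Plane) {ρ : ℝ} (hx : |pj a z - x| ≤ ρ) :
    closedBall z (δ / (1 + A)) ⊆ tube a x (ρ + δ) := by
  intro p hp
  have hA := (abs_nonneg a).trans ha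
  rw [mem_closedBall, le_div_iff₀ (by linarith)] at hp
  have h1 := pj_dist ha p z
  have h2 := abs_sub_le (pj a p) (pj a z) x
  show |pj a p - x| ≤ ρ + δ
  nlinarith

lemma tube_sub {a x y r s : ℝ} (h : |y - x| + r ≤ s) : tube a y r ⊆ tube a x s := by
  intro p hp
  have h2 := abs_sub_le (pj a p) y x
  have : |pj a p - y| ≤ r := hp
  show |pj a p - x| ≤ s
  linarith

lemma gk_eq (μ : Measure Plane) [IsFiniteMeasure μ] (δ R a x : ℝ) :
    gk μ δ R (a, x) = μ.real (tube a x (2*δ)) / (4*δ) - μ.real (tube a x R) / (2*R) := by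
  unfold gk hk
  have e : ∀ (r c : ℝ) (z : Plane), (Icc (-r) r).indicator (fun _ => c) (pj a z - x) =
      (tube a x r).indicator (fun _ => c) z := by
    intro r c z
    have hiff : (pj a z - x ∈ Icc (-r) r) ↔ z ∈ tube a x r := by rw [mem_Icc, ← abs_le]; rfl
    by_cases h : z ∈ tube a x r
    · rw [indicator_of_mem h, indicator_of_mem (hiff.mpr h)]
    · rw [indicator_of_notMem h, indicator_of_notMem (fun h' => h (hiff.mp h'))]
  simp only [e]
  have i : ∀ r c : ℝ, Integrable ((tube a x r).indicator (fun _ => c)) μ := by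
    intro r c
    rw [integrable_indicator_iff (tube_closed a x r).measurableSet]
    exact integrableOn_const (by simp)
  rw [integral_sub (i _ _) (i _ _), integral_indicator_const _ (tube_closed _ _ _).measurableSet,
    integral_indicator_const _ (tube_closed _ _ _).measurableSet]
  simp only [smul_eq_mul]; ring

lemma count (μ : Measure Plane) [IsFiniteMeasure μ] (k : ℕ) (S : Finset (Fin 2 → ℤ))
    (z : (Fin 2 → ℤ) → Plane) (hz : ∀ m ∈ S, z m ∈ dyadicCube 2 k m)
    {δ N a A c t β M : ℝ} (hδ : δ = (1/2)^k) (hN : 2 ≤ N) (ha : |a| ≤ A) (hc : 0 < c)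
    (hlow : ∀ m ∈ S, ENNReal.ofReal (c * (δ / (1 + A))^t) ≤ μ (closedBall (z m) (δ / (1 + A))))
    (hM : ∀ m ∈ S, |pj a (z m)| + δ ≤ M)
    (hb1 : ∀ m ∈ S, δ ^ β ≤ μ.real (tube a (pj a (z m)) δ))
    (hb2 : ∀ m ∈ S, 8 * μ.real (tube a (pj a (z m)) (2 * N * δ))
      ≤ 2 * N * μ.real (tube a (pj a (z m)) δ)) :
    (S.card : ℝ≥0∞) ≤ ENNReal.ofReal (288 * (1 + A)^t / c * δ ^ (1 - β - t)) *
      ∫⁻ x in Icc (-M) M, ENNReal.ofReal ((gk μ δ (N * δ) (a, x))^2) := by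
  classical
  have hA := (abs_nonneg a).trans ha
  have hδp : 0 < δ := by rw [hδ]; positivity
  have hrle : δ / (1 + A) ≤ (1/2)^k := by
    rw [← hδ]; exact div_le_self hδp.le (by linarith)
  have hpt : ∀ x, ∑ m ∈ S, (Icc (pj a (z m) - δ) (pj a (z m) + δ)).indicator (fun _ => (1:ℝ≥0∞)) x
      ≤ ENNReal.ofReal (576 * (1 + A)^t / c * δ ^ (2 - β - t)) *
        ENNReal.ofReal ((gk μ δ (N * δ) (a, x))^2) := by
    intro x
    set T := S.filter (fun m => x ∈ Icc (pj a (z m) - δ) (pj a (z m) + δ)) with hT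
    have e : ∑ m ∈ S, (Icc (pj a (z m) - δ) (pj a (z m) + δ)).indicator (fun _ => (1:ℝ≥0∞)) x
        = (T.card : ℝ≥0∞) := by
      rw [hT]; simp only [indicator, Finset.sum_ite]; simp
    rw [e]
    rcases T.eq_empty_or_nonempty with h0 | ⟨m0, hm0⟩
    · rw [h0]; simp
    have hx : ∀ m ∈ T, m ∈ S ∧ |pj a (z m) - x| ≤ δ := by
      intro m hm
      rw [hT, Finset.mem_filter, mem_Icc] at hm
      refine ⟨hm.1, ?_⟩
      rw [abs_le]; constructor <;> linarith [hm.2.1, hm.2.2]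
    have hpk := packing μ k T z (fun m hm => hz m (hx m hm).1) _ hrle _
      (fun m hm => hlow m (hx m hm).1) (tube a x (2*δ)) (tube_closed _ _ _).measurableSet
      (fun m hm => by
        have := ball_tube (δ := δ) ha (z m) (hx m hm).2
        rwa [← two_mul] at this)
    rw [← ofReal_measureReal, ← ENNReal.ofReal_natCast, ← ENNReal.ofReal_mul (by positivity),
      ← ENNReal.ofReal_ofNat 9, ← ENNReal.ofReal_mul (by norm_num),
      ENNReal.ofReal_le_ofReal_iff (by positivity)] at hpk
    rw [← ENNReal.ofReal_natCast, ← ENNReal.ofReal_mul (by positivity)]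
    apply ENNReal.ofReal_le_ofReal
    rw [gk_eq]
    obtain ⟨hmS, hmx⟩ := hx m0 hm0
    have t1 : μ.real (tube a (pj a (z m0)) δ) ≤ μ.real (tube a x (2*δ)) :=
      measureReal_mono (tube_sub (by linarith))
    have t2 : μ.real (tube a x (N*δ)) ≤ μ.real (tube a (pj a (z m0)) (2*N*δ)) := by
      refine measureReal_mono (tube_sub ?_)
      rw [abs_sub_comm]; nlinarith
    have b1 := hb1 m0 hmS
    have b2 := hb2 m0 hmS
    set X := μ.real (tube a x (2*δ))
    set Y := μ.real (tube a x (N*δ))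
    have hg : X / (8 * δ) ≤ X / (4*δ) - Y / (2 * (N*δ)) := by
      have : Y / (2 * (N * δ)) ≤ X / (8 * δ) := by
        rw [div_le_div_iff₀ (by positivity) (by positivity)]
        have h8 : 8 * Y ≤ 2 * N * X := by
          have : 2 * N * μ.real (tube a (pj a (z m0)) δ) ≤ 2 * N * X := by gcongr
          linarith
        nlinarith
      have h2 : X / (4*δ) = X / (8*δ) + X / (8*δ) := by field_simp; ring
      linarith
    have hXp : 0 ≤ X := measureReal_nonneg
    have hXb : δ^β ≤ X := b1.trans t1
    have hgsq : (X / (8 * δ))^2 ≤ (X / (4*δ) - Y / (2 * (N*δ)))^2 := by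
      gcongr
    have hc' : 0 < c * (δ / (1 + A))^t := by positivity
    calc (T.card : ℝ) ≤ 9 * X / (c * (δ / (1 + A))^t) := by
          rw [le_div_iff₀ hc']; exact hpk
      _ ≤ 9 * (X * (X / δ^β)) / (c * (δ / (1 + A))^t) := by
          gcongr
          apply le_mul_of_one_le_right hXp
          rw [le_div_iff₀ (by positivity)]; linarith
      _ = 576 * (1 + A)^t / c * δ ^ (2 - β - t) * (X / (8 * δ))^2 := by
          rw [Real.div_rpow hδp.le (by linarith), Real.rpow_sub hδp, Real.rpow_sub hδp]
          norm_num
          field_simp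
          ring
      _ ≤ _ := by gcongr
  have hI : ∀ m ∈ S, ∫⁻ x in Icc (-M) M,
      (Icc (pj a (z m) - δ) (pj a (z m) + δ)).indicator (fun _ => (1:ℝ≥0∞)) x
      = ENNReal.ofReal (2 * δ) := by
    intro m hm
    rw [lintegral_indicator_const measurableSet_Icc, one_mul, Measure.restrict_apply measurableSet_Icc,
      inter_eq_left.mpr, Real.volume_Icc]
    · congr 1; ring
    · have h1 := hM m hm
      have h2 := abs_le.mp (show |pj a (z m)| ≤ M - δ by linarith)
      apply Icc_subset_Icc <;> linarith
  have main : (S.card : ℝ≥0∞) * ENNReal.ofReal (2 * δ) ≤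
      ENNReal.ofReal (576 * (1 + A)^t / c * δ ^ (2 - β - t)) *
      ∫⁻ x in Icc (-M) M, ENNReal.ofReal ((gk μ δ (N * δ) (a, x))^2) := by
    rw [← lintegral_const_mul']
    · refine le_trans (le_of_eq ?_) (lintegral_mono hpt)
      rw [lintegral_finsetSum]
      · rw [Finset.sum_congr rfl hI]; simp
      · exact fun m _ => measurable_const.indicator measurableSet_Icc
    · exact ENNReal.ofReal_ne_top
  have h2δ : ENNReal.ofReal (2*δ) ≠ 0 := by simp [hδp]
  rw [← ENNReal.mul_le_mul_iff_left h2δ ENNReal.ofReal_ne_top]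
  refine main.trans (le_of_eq ?_)
  rw [mul_right_comm, ← ENNReal.ofReal_mul (by positivity)]
  congr 2
  rw [show 2 - β - t = (1 - β - t) + 1 by ring, Real.rpow_add hδp, Real.rpow_one]
  ring

def Bad (μ : Measure Plane) (N β a : ℝ) (k : ℕ) (z : Plane) : Prop :=
  ((1/2:ℝ)^k) ^ β ≤ μ.real (tube a (pj a z) ((1/2)^k)) ∧
    8 * μ.real (tube a (pj a z) (2 * N * (1/2)^k)) ≤ 2 * N * μ.real (tube a (pj a z) ((1/2)^k))

lemma cube_ediam (k : ℕ) (m : Fin 2 → ℤ) :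
    ediam (dyadicCube 2 k m) ≤ ENNReal.ofReal (2 * (1/2)^k) := by
  refine ediam_le fun x hx y hy => ?_
  rw [edist_dist]
  apply ENNReal.ofReal_le_ofReal
  rw [dist_eq_norm]
  refine (norm_le_coord _).trans ?_
  have h : ∀ i : Fin 2, |(x - y) i| ≤ (1/2)^k := by
    intro i
    have h1 := hx i
    have h2 := hy i
    have e : (2:ℝ)^(-(k:ℤ)) = (1/2)^k := by rw [zpow_neg, zpow_natCast]; simp
    rw [e] at h1 h2
    rw [PiLp.sub_apply, abs_le]
    constructor <;> nlinarith [h1.1, h1.2, h2.1, h2.2]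
  linarith [h 0, h 1]

lemma mem_some_cube (k : ℕ) (z : Plane) : ∃ m, z ∈ dyadicCube 2 k m := by
  refine ⟨fun i => ⌊z i * 2^k⌋, fun i => ?_⟩
  have hp : (0:ℝ) < 2^k := by positivity
  rw [zpow_neg, zpow_natCast, ← div_eq_mul_inv, ← div_eq_mul_inv, div_le_iff₀ hp,
    lt_div_iff₀ hp]
  exact ⟨Int.floor_le _, Int.lt_floor_add_one _⟩

/-- The covering argument for one fixed slope. -/
lemma cover (P : ℕ → Plane → Prop) (K : Set Plane) (u : ℝ) (hu : 0 < u) (k0 : ℕ) (g : ℕ → ℝ≥0∞)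
    (hg : ∑' k, g k ≠ ∞)
    (hcount : ∀ k, ∀ (S : Finset (Fin 2 → ℤ)) (z : (Fin 2 → ℤ) → Plane),
      (∀ m ∈ S, z m ∈ dyadicCube 2 (k + k0) m ∧ z m ∈ K ∧ P (k + k0) (z m)) →
      (S.card : ℝ≥0∞) * (ENNReal.ofReal (2 * (1/2)^(k+k0)))^u ≤ g k) :
    μH[u] {z | z ∈ K ∧ ∀ n, ∃ k, n ≤ k ∧ P k z} = 0 := by
  classical
  set B := {z | z ∈ K ∧ ∀ n, ∃ k, n ≤ k ∧ P k z} with hB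
  let T : ∀ n : ℕ, (ℕ × (Fin 2 → ℤ)) → Set Plane := fun n q =>
    dyadicCube 2 (q.1 + n + k0) q.2 ∩ {z | z ∈ K ∧ P (q.1 + n + k0) z}
  have h1 : μH[u] B ≤ Filter.liminf (fun n => ∑' i, ediam (T n i) ^ u) Filter.atTop := by
    refine Measure.hausdorffMeasure_le_liminf_tsum u B
      (fun n => ENNReal.ofReal (2 * (1/2)^n)) ?_ T ?_ ?_
    · rw [← ENNReal.ofReal_zero]
      apply ENNReal.tendsto_ofReal
      have := (tendsto_pow_atTop_nhds_zero_of_lt_one (r := (1/2:ℝ)) (by norm_num) (by norm_num)).const_mul 2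
      simpa using this
    · refine Filter.Eventually.of_forall fun n q => ?_
      refine (ediam_mono inter_subset_left).trans ((cube_ediam _ _).trans ?_)
      apply ENNReal.ofReal_le_ofReal
      gcongr 2 * ?_
      apply pow_le_pow_of_le_one (by norm_num) (by norm_num); omega
    · refine Filter.Eventually.of_forall fun n z hz => ?_
      obtain ⟨hzK, hz⟩ := hz
      obtain ⟨k, hk, hP⟩ := hz (n + k0)
      obtain ⟨m, hm⟩ := mem_some_cube k z
      have e : k - n - k0 + n + k0 = k := by omega
      refine mem_iUnion.mpr ⟨(k - n - k0, m), ?_, hzK, ?_⟩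
      · show z ∈ dyadicCube 2 (k - n - k0 + n + k0) m
        rwa [e]
      · show P (k - n - k0 + n + k0) z
        rwa [e]
  have h2 : ∀ n, ∑' i, ediam (T n i) ^ u ≤ ∑' k, g (k + n) := by
    intro n
    rw [ENNReal.tsum_prod (f := fun k m => ediam (T n (k, m)) ^ u)]
    refine ENNReal.tsum_le_tsum fun k => ?_
    rw [ENNReal.tsum_eq_iSup_sum]
    refine iSup_le fun S => ?_
    set S' := S.filter (fun m => (T n (k, m)).Nonempty) with hS'
    have e1 : ∑ m ∈ S, ediam (T n (k, m)) ^ u = ∑ m ∈ S', ediam (T n (k, m)) ^ u := by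
      rw [hS', Finset.sum_filter]
      refine Finset.sum_congr rfl fun m _ => ?_
      split_ifs with h
      · rfl
      · rw [not_nonempty_iff_eq_empty.mp h, ediam_empty, ENNReal.zero_rpow_of_pos hu]
    rw [e1]
    have hne : ∀ m, ∃ z, m ∈ S' → z ∈ T n (k, m) := by
      intro m
      by_cases h : m ∈ S'
      · obtain ⟨z, hz⟩ := (Finset.mem_filter.mp h).2
        exact ⟨z, fun _ => hz⟩
      · exact ⟨0, fun h' => absurd h' h⟩
    choose z hz using hne
    refine le_trans ?_ (hcount (k + n) S' z (fun m hm => ⟨(hz m hm).1, (hz m hm).2.1, (hz m hm).2.2⟩))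
    rw [← nsmul_eq_mul]
    refine Finset.sum_le_card_nsmul _ _ _ fun m _ => ?_
    apply ENNReal.rpow_le_rpow _ hu.le
    exact (ediam_mono inter_subset_left).trans (cube_ediam _ _)
  have h3 := ENNReal.tendsto_sum_nat_add g hg
  rw [← nonpos_iff_eq_zero]
  refine h1.trans ?_
  rw [← h3.liminf_eq]
  exact Filter.liminf_le_liminf (Filter.Eventually.of_forall h2)

lemma ae_null (μ : Measure Plane) [IsFiniteMeasure μ] (K : Set Plane) (hKc : μ Kᶜ = 0)
    {t C A N c β u d ρ : ℝ} (hC : 0 ≤ C) (ht2 : t < 2) (hA : 0 ≤ A) (hN : 2 ≤ N) (hc : 0 < c)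
    (hd : 0 < d) (hu : 0 < u) (huβ : β < u)
    (hρ : ∀ z ∈ K, ‖z‖ ≤ ρ)
    (hup : ∀ x ∈ K, ∀ r : ℝ, 0 < r → μ (closedBall x r) ≤ ENNReal.ofReal (C * r ^ t))
    (hlow : ∀ x ∈ K, ∀ r : ℝ, 0 < r → r ≤ d → ENNReal.ofReal (c * r ^ t) ≤ μ (closedBall x r)) :
    ∀ᵐ a : ℝ, |a| < A → μH[u] {z | z ∈ K ∧ ∀ n, ∃ k, n ≤ k ∧ Bad μ N β a k z} = 0 := by
  obtain ⟨D, hD, hE⟩ := energy μ K hKc hC ht2 hA hN hup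
  have hNp : 0 < N := by linarith
  obtain ⟨k0, hk0⟩ := exists_pow_lt_of_lt_one (show 0 < min d (1/N) by positivity)
    (show (1/2:ℝ) < 1 by norm_num)
  set M := (1 + A) * ρ + 1 with hM
  let δ : ℕ → ℝ := fun k => (1/2)^(k + k0)
  have hδp : ∀ k, 0 < δ k := fun k => by positivity
  have hδle : ∀ k, δ k ≤ (1/2)^k0 := fun k =>
    pow_le_pow_of_le_one (by norm_num) (by norm_num) (by omega)
  have hδd : ∀ k, δ k ≤ d := fun k => (hδle k).trans (hk0.le.trans (min_le_left _ _))
  have hδN : ∀ k, N * δ k ≤ 1 := fun k => by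
    have := (hδle k).trans (hk0.le.trans (min_le_right _ _))
    rw [le_div_iff₀ hNp] at this; linarith
  have hpj : ∀ z ∈ K, ∀ a, |a| ≤ A → |pj a z| ≤ (1 + A) * ρ := by
    intro z hz a ha
    have := pj_dist ha z 0
    rw [dist_zero_right] at this
    have e0 : pj a 0 = 0 := by simp [pj]
    rw [e0, sub_zero] at this
    refine this.trans ?_
    gcongr
    exact hρ z hz
  let G : ℕ → ℝ → ℝ≥0∞ := fun k a =>
    ∫⁻ x in Icc (-M) M, ENNReal.ofReal ((gk μ (δ k) (N * δ k) (a, x))^2)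
  have mg : ∀ k, Measurable (fun p : ℝ × ℝ => ENNReal.ofReal ((gk μ (δ k) (N * δ k) p)^2)) :=
    fun k => ((gk_meas μ _ _).pow_const 2).ennreal_ofReal
  have mG : ∀ k, Measurable (G k) := fun k => (mg k).lintegral_prod_right'
  have mchi : Measurable (fun a => ENNReal.ofReal (chi A a)) :=
    (chi_cont A).measurable.ennreal_ofReal
  have eG : ∀ k, ∫⁻ a in Icc (-A) A, ENNReal.ofReal (chi A a) * G k a ≤
      ENNReal.ofReal (D * δ k ^ (t - 1)) := by
    intro k
    refine le_trans (le_of_eq ?_) (hE (δ k) (N * δ k) M (hδp k) rfl ?_)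
    · rw [lintegral_prod]
      · refine lintegral_congr fun a => ?_
        simp only [G]
        rw [← lintegral_const_mul']
        · refine lintegral_congr fun x => ?_
          rw [ENNReal.ofReal_mul (chi_nonneg _ _)]
        · exact ENNReal.ofReal_ne_top
      · apply Measurable.aemeasurable
        exact (((chi_cont A).measurable.comp measurable_fst).mul
          ((gk_meas μ _ _).pow_const 2)).ennreal_ofReal
    · intro z hz a ha
      linarith [hpj z hz a ha, hδN k]
  let w : ℕ → ℝ≥0∞ := fun k => ENNReal.ofReal (δ k ^ (1 - β - t + u))
  have mcG : ∀ k, Measurable (fun a => ENNReal.ofReal (chi A a) * G k a) :=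
    fun k => mchi.mul (mG k)
  have mwG : ∀ k, Measurable (fun a => w k * (ENNReal.ofReal (chi A a) * G k a)) :=
    fun k => (mcG k).const_mul _
  have hsum : ∫⁻ a in Icc (-A) A, ∑' k, w k * (ENNReal.ofReal (chi A a) * G k a) ≠ ∞ := by
    rw [lintegral_tsum (fun k => (mwG k).aemeasurable)]
    have hb : ∀ k, ∫⁻ a in Icc (-A) A, w k * (ENNReal.ofReal (chi A a) * G k a) ≤
        ENNReal.ofReal (D * ((1/2:ℝ)^k0)^(u - β) * ((1/2:ℝ)^(u - β))^k) := by
      intro k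
      rw [lintegral_const_mul _ (mcG k)]
      refine (mul_le_mul_right (eG k) _).trans ?_
      simp only [w]
      rw [← ENNReal.ofReal_mul (by have := hδp k; positivity)]
      apply ENNReal.ofReal_le_ofReal
      apply le_of_eq
      rw [mul_left_comm, ← Real.rpow_add (hδp k), mul_assoc]
      congr 1
      rw [show 1 - β - t + u + (t - 1) = u - β by ring]
      simp only [δ]
      rw [pow_add, Real.mul_rpow (by positivity) (by positivity), mul_comm]
      congr 1
      rw [← Real.rpow_natCast_mul (by norm_num), mul_comm (k:ℝ), Real.rpow_mul_natCast (by norm_num)]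
    have hlt : (1/2:ℝ)^(u-β) < 1 := Real.rpow_lt_one (by norm_num) (by norm_num) (by linarith)
    refine ne_top_of_le_ne_top ?_ (ENNReal.tsum_le_tsum hb)
    rw [← ENNReal.ofReal_tsum_of_nonneg (fun k => by positivity)
      ((summable_geometric_of_lt_one (by positivity) hlt).mul_left _)]
    exact ENNReal.ofReal_ne_top
  have hae := ae_lt_top (Measurable.tsum fun k => mwG k) hsum
  rw [ae_restrict_iff' measurableSet_Icc] at hae
  filter_upwards [hae] with a ha haA
  have hfin := ha (by rw [mem_Icc, ← abs_le]; exact haA.le)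
  have hS : ∑' k, w k * G k a ≠ ∞ := by
    have e : ∑' k, w k * (ENNReal.ofReal (chi A a) * G k a)
        = ENNReal.ofReal (chi A a) * ∑' k, w k * G k a := by
      rw [← ENNReal.tsum_mul_left]
      refine tsum_congr fun k => ?_
      ring
    rw [e] at hfin
    intro h
    rw [h, ENNReal.mul_top (by simpa using chi_pos haA)] at hfin
    exact lt_irrefl _ hfin
  set E := 288 * (1 + A)^t / c * 2^u with hEdef
  refine cover (Bad μ N β a) K u hu k0 (fun k => ENNReal.ofReal E * (w k * G k a)) ?_ ?_
  · rw [ENNReal.tsum_mul_left]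
    exact ENNReal.mul_ne_top ENNReal.ofReal_ne_top hS
  · intro k S z hz
    have hcnt := count μ (k + k0) S z (fun m hm => (hz m hm).1) (δ := δ k) (N := N) (a := a) (A := A)
      (c := c) (t := t) (β := β) (M := M) rfl hN haA.le hc ?_ ?_ ?_ ?_
    · refine (mul_le_mul_left hcnt _).trans (le_of_eq ?_)
      rw [ENNReal.ofReal_rpow_of_nonneg (by positivity) hu.le]
      simp only [w]
      rw [mul_right_comm, ← mul_assoc, ← ENNReal.ofReal_mul (by have := hδp k; positivity),
        ← ENNReal.ofReal_mul (by positivity)]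
      congr 2
      rw [Real.mul_rpow (by norm_num) (by positivity), Real.rpow_add (hδp k)]
      simp only [δ, hEdef]
      ring
    · intro m hm
      refine hlow _ (hz m hm).2.1 _ (by have := hδp k; positivity) ?_
      exact (div_le_self (hδp k).le (by linarith)).trans (hδd k)
    · intro m hm
      have h1 := hpj _ (hz m hm).2.1 a haA.le
      have h2 := hδN k
      nlinarith [hδp k]
    · exact fun m hm => (hz m hm).2.2.1
    · exact fun m hm => (hz m hm).2.2.2

lemma record (q : ℕ → ℝ) (hub : ∀ M, ∃ k, M < q k) (n : ℕ) :
    ∃ k, n ≤ k ∧ 1 ≤ q k ∧ ∀ j, j < k → q j ≤ q k := by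
  classical
  have hsn : 0 ≤ ∑ j ∈ Finset.range n, |q j| := Finset.sum_nonneg fun _ _ => abs_nonneg _
  have hex := hub (1 + ∑ j ∈ Finset.range n, |q j|)
  have h1 := Nat.find_spec hex
  refine ⟨Nat.find hex, ?_, by linarith, fun j hj => ?_⟩
  · by_contra h
    push Not at h
    have h2 := Finset.single_le_sum (f := fun j => |q j|) (fun _ _ => abs_nonneg _)
      (Finset.mem_range.2 h)
    have h3 := le_abs_self (q (Nat.find hex))
    simp only at h2
    linarith
  · have := Nat.find_min hex hj
    linarith

lemma cov_tube (μ : Measure Plane) [IsFiniteMeasure μ] (K : Set Plane)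
    {t A c d a : ℝ} (hc : 0 < c) (ha : |a| ≤ A)
    (hlow : ∀ x ∈ K, ∀ r : ℝ, 0 < r → r ≤ d → ENNReal.ofReal (c * r ^ t) ≤ μ (closedBall x r))
    (z : Plane) (P : Set Plane) (hP : P ⊆ K) (hPz : ∀ w ∈ P, pj a w = pj a z) (k : ℕ)
    (hk : (1/2:ℝ)^k ≤ d) :
    (covNum 2 k P : ℝ) * (c * ((1/2:ℝ)^k / (1 + A))^t) ≤
      9 * μ.real (tube a (pj a z) ((1/2)^k)) := by
  classical
  have hA := (abs_nonneg a).trans ha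
  have hnn : 0 ≤ μ.real (tube a (pj a z) ((1/2)^k)) := measureReal_nonneg
  by_cases hfin : {m : Fin 2 → ℤ | (dyadicCube 2 k m ∩ P).Nonempty}.Finite
  swap
  · unfold covNum
    rw [Set.Infinite.ncard hfin]
    simp
  have hex : ∀ m : Fin 2 → ℤ, ∃ w : Plane, (dyadicCube 2 k m ∩ P).Nonempty →
      w ∈ dyadicCube 2 k m ∩ P := by
    intro m
    by_cases h : (dyadicCube 2 k m ∩ P).Nonempty
    · exact ⟨h.some, fun _ => h.some_mem⟩
    · exact ⟨0, fun h' => absurd h' h⟩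
  choose w hw using hex
  have hmem : ∀ m ∈ hfin.toFinset, w m ∈ dyadicCube 2 k m ∩ P := fun m hm =>
    hw m (by simpa using hm)
  have hδ : (0:ℝ) < (1/2)^k := by positivity
  have hle : (1/2:ℝ)^k / (1 + A) ≤ (1/2)^k := div_le_self hδ.le (by linarith)
  have hp := packing μ k hfin.toFinset w (fun m hm => (hmem m hm).1) ((1/2:ℝ)^k / (1 + A)) hle
    (ENNReal.ofReal (c * ((1/2:ℝ)^k / (1 + A))^t))
    (fun m hm => hlow _ (hP (hmem m hm).2) _ (by positivity) (hle.trans hk))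
    (tube a (pj a z) ((1/2)^k)) (tube_closed _ _ _).measurableSet ?_
  · have hcard : hfin.toFinset.card = covNum 2 k P := (Set.ncard_eq_toFinset_card _ hfin).symm
    rw [hcard] at hp
    have := ENNReal.toReal_mono (ENNReal.mul_ne_top (by simp) (measure_ne_top _ _)) hp
    rw [ENNReal.toReal_mul, ENNReal.toReal_mul, ENNReal.toReal_ofReal (by positivity)] at this
    simpa [Measure.real] using this
  · intro m hm
    have := ball_tube (δ := (1/2:ℝ)^k) (x := pj a z) ha (w m) (ρ := 0)
      (by rw [hPz _ (hmem m hm).2]; simp)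
    rwa [zero_add] at this

lemma bad_freq (μ : Measure Plane) [IsFiniteMeasure μ] (K : Set Plane)
    {t A c d a s s' : ℝ} (hc : 0 < c) (hd : 0 < d) (ha : |a| ≤ A) (hs0 : 0 < s') (hs' : s' < s)
    (hlow : ∀ x ∈ K, ∀ r : ℝ, 0 < r → r ≤ d → ENNReal.ofReal (c * r ^ t) ≤ μ (closedBall x r))
    (z : Plane) (P : Set Plane) (hP : P ⊆ K) (hPz : ∀ w ∈ P, pj a w = pj a z)
    (hdim : s ≤ upperBoxDim P) (L : ℕ) (hL : 8 * ((2:ℝ)^L)^(t - s') ≤ 2^L) (n : ℕ) :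
    ∃ k, n ≤ k ∧ Bad μ (2^L/2) (t - s') a k z := by
  have hA := (abs_nonneg a).trans ha
  obtain ⟨σ, h1, h2⟩ := exists_between hs'
  set β := t - s' with hβ
  let δ : ℕ → ℝ := fun k => (1/2)^k
  have hδ : ∀ k, 0 < δ k := fun k => by positivity
  let T : ℕ → ℝ := fun k => μ.real (tube a (pj a z) (δ k))
  have hfreq : ∃ᶠ k : ℕ in Filter.atTop,
      σ < Real.log (covNum 2 k P) / ((k : ℝ) * Real.log 2) := by
    apply Filter.frequently_lt_of_lt_limsup
    · apply Filter.isCoboundedUnder_le_of_le Filter.atTop (x := 0)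
      intro k
      have := Real.log_natCast_nonneg (covNum 2 k P)
      positivity
    · exact h2.trans_le hdim
  set B := c / (1 + A)^t / 9 with hB
  have hBp : 0 < B := by positivity
  have hub : ∀ M, ∃ k, M < T k / (δ k)^β := by
    intro M
    have e1 : ∀ᶠ k : ℕ in Filter.atTop, δ k < d :=
      (tendsto_pow_atTop_nhds_zero_of_lt_one (by norm_num) (by norm_num)).eventually_lt_const hd
    have hη : (1:ℝ) < 2^(σ - s') := Real.one_lt_rpow (by norm_num) (by linarith)
    have e2 : ∀ᶠ k : ℕ in Filter.atTop, M < B * (2^(σ-s'))^k :=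
      ((tendsto_pow_atTop_atTop_of_one_lt hη).const_mul_atTop hBp).eventually_gt_atTop M
    obtain ⟨k, hk, hk1, hk2, hk3⟩ := (hfreq.and_eventually
      (e1.and (e2.and (Filter.eventually_ge_atTop 1)))).exists
    refine ⟨k, hk2.trans_le ?_⟩
    have hcov := cov_tube μ K hc ha hlow z P hP hPz k hk1.le
    have hkp : (0:ℝ) < k := by exact_mod_cast hk3
    have hl2 := Real.log_pos (one_lt_two)
    rw [lt_div_iff₀ (by positivity)] at hk
    have hcp : (0:ℝ) < covNum 2 k P := by
      rcases Nat.eq_zero_or_pos (covNum 2 k P) with h | h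
      · rw [h] at hk
        simp at hk
        have : 0 < σ * (k * Real.log 2) := by have := hs0.trans h1; positivity
        linarith
      · exact_mod_cast h
    have hge : (δ k)^(-σ) ≤ covNum 2 k P := by
      rw [Real.rpow_def_of_pos (hδ k), ← Real.le_log_iff_exp_le hcp]
      have : Real.log (δ k) = - (k * Real.log 2) := by
        simp [δ, Real.log_pow]
      rw [this]; linarith
    rw [le_div_iff₀ (by have := hδ k; positivity)]
    have hid : (2^(σ-s') : ℝ)^k = (δ k)^(-σ + s') := by
      have : δ k = (2^k)⁻¹ := by simp [δ]
      rw [this, Real.inv_rpow (by positivity), ← Real.rpow_neg (by positivity),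
        ← Real.rpow_mul_natCast (by norm_num), mul_comm, Real.rpow_natCast_mul (by norm_num)]
      congr 1; ring
    have hmain : (δ k)^(-σ) * (c * (δ k / (1 + A))^t) ≤ 9 * T k :=
      (mul_le_mul_of_nonneg_right hge (by have := hδ k; positivity)).trans hcov
    rw [Real.div_rpow (hδ k).le (by linarith)] at hmain
    have hcalc : 9 * (B * (2^(σ-s') : ℝ)^k * (δ k)^β) =
        (δ k)^(-σ) * (c * ((δ k)^t / (1 + A)^t)) := by
      rw [hid, mul_assoc, ← Real.rpow_add (hδ k), show -σ + s' + β = -σ + t by rw [hβ]; ring,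
        Real.rpow_add (hδ k), hB]
      ring
    linarith
  obtain ⟨k, hkn, hk1, hkj⟩ := record _ hub (n + L)
  refine ⟨k, by omega, ?_, ?_⟩
  · rw [le_div_iff₀ (by have := hδ k; positivity), one_mul] at hk1
    exact hk1
  · have hLp : (0:ℝ) < 2^L := by positivity
    have hs : 2 * (2^L/2) * (1/2:ℝ)^k = δ (k - L) := by
      obtain ⟨j, rfl⟩ : ∃ j, k = j + L := ⟨k - L, by omega⟩
      simp only [δ, Nat.add_sub_cancel, pow_add]
      rw [mul_div_cancel₀ _ (by norm_num : (2:ℝ) ≠ 0), mul_left_comm, ← mul_pow]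
      norm_num
    rw [hs]
    show 8 * T (k - L) ≤ 2 * (2^L/2) * T k
    have hTk : 0 ≤ T k := measureReal_nonneg
    have hj : T (k - L) / (δ (k-L))^β ≤ T k / (δ k)^β := by
      rcases Nat.eq_zero_or_pos L with h | h
      · subst h; simp
      · exact hkj _ (by omega)
    have hs2 : δ (k - L) = 2^L * δ k := by rw [← hs]; ring
    rw [hs2, Real.mul_rpow hLp.le (hδ k).le, div_le_div_iff₀ (by have := hδ k; positivity)
      (by have := hδ k; positivity), ← mul_assoc] at hj
    have hj' := le_of_mul_le_mul_right hj (by have := hδ k; positivity)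
    nlinarith

lemma good_slope (μ : Measure Plane) [IsFiniteMeasure μ] (K : Set Plane) (hKc : μ Kᶜ = 0)
    {t C A c s s' u d ρ : ℝ} (hC : 0 ≤ C) (ht2 : t < 2) (hA : 0 ≤ A) (hc : 0 < c)
    (hd : 0 < d) (hu : 0 < u) (huβ : t - s' < u) (hs0 : 0 < s') (hst : t - 1 < s') (hss : s' < s)
    (hρ : ∀ z ∈ K, ‖z‖ ≤ ρ)
    (hup : ∀ x ∈ K, ∀ r : ℝ, 0 < r → μ (closedBall x r) ≤ ENNReal.ofReal (C * r ^ t))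
    (hlow : ∀ x ∈ K, ∀ r : ℝ, 0 < r → r ≤ d → ENNReal.ofReal (c * r ^ t) ≤ μ (closedBall x r)) :
    ∀ᵐ a : ℝ, |a| < A → ∀ e : Plane, e 1 = a * e 0 →
      μH[u] {z | z ∈ K ∧ s ≤ upperBoxDim (K ∩ lineThrough e z)} = 0 := by
  have hη : (1:ℝ) < 2^(1 - (t - s')) := Real.one_lt_rpow (by norm_num) (by linarith)
  obtain ⟨L, hL8, hL2⟩ := (((tendsto_pow_atTop_atTop_of_one_lt hη).eventually_ge_atTop 8).and
    (Filter.eventually_ge_atTop 2)).exists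
  have hL : 8 * ((2:ℝ)^L)^(t - s') ≤ 2^L := by
    rw [← Real.rpow_mul_natCast (by norm_num), mul_comm, Real.rpow_natCast_mul (by norm_num),
      Real.rpow_sub (by positivity), Real.rpow_one, le_div_iff₀ (by positivity)] at hL8
    exact hL8
  have hN : (2:ℝ) ≤ 2^L/2 := by
    have : (2:ℝ)^2 ≤ 2^L := pow_le_pow_right₀ (by norm_num) hL2
    linarith
  filter_upwards [ae_null μ K hKc hC ht2 hA hN hc hd hu huβ hρ hup hlow] with a ha haA e he
  refine measure_mono_null ?_ (ha haA)
  rintro z ⟨hz, hdim⟩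
  refine ⟨hz, fun n => bad_freq μ K hc hd haA.le hs0 hss hlow z _ inter_subset_left ?_ hdim L hL n⟩
  rintro w ⟨-, r, rfl⟩
  simp [pj, he]
  ring

def arcpt (a : ℝ) : Plane := !₂[Real.cos (Real.arctan a), Real.sin (Real.arctan a)]

lemma arctan_lip (a b : ℝ) : |Real.arctan a - Real.arctan b| ≤ |a - b| := by
  have h : LipschitzWith 1 Real.arctan := by
    apply lipschitzWith_of_nnnorm_deriv_le Real.differentiable_arctan
    intro x
    rw [← NNReal.coe_le_coe, coe_nnnorm, Real.deriv_arctan, Real.norm_eq_abs, abs_of_nonneg (by positivity)]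
    simp only [NNReal.coe_one]
    rw [div_le_one (by positivity)]
    nlinarith [sq_nonneg x]
  simpa [Real.dist_eq] using h.dist_le_mul a b

lemma arcpt_lip : LipschitzWith 2 arcpt := by
  apply LipschitzWith.of_dist_le_mul
  intro a b
  have h1 := Real.abs_cos_sub_cos_le (Real.arctan a) (Real.arctan b)
  have h2 := Real.abs_sin_sub_sin_le (Real.arctan a) (Real.arctan b)
  have h3 := arctan_lip a b
  rw [EuclideanSpace.dist_eq, Fin.sum_univ_two]
  simp only [arcpt, Real.dist_eq]
  apply Real.sqrt_le_iff.2
  simp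
  have h4 := sq_le_sq' (by linarith [neg_abs_le (Real.cos (Real.arctan a) - Real.cos (Real.arctan b)), abs_nonneg (a-b), abs_nonneg (Real.cos (Real.arctan a) - Real.cos (Real.arctan b))]) ((le_abs_self _).trans (h1.trans h3))
  have h5 := sq_le_sq' (by linarith [neg_abs_le (Real.sin (Real.arctan a) - Real.sin (Real.arctan b)), abs_nonneg (a-b), abs_nonneg (Real.sin (Real.arctan a) - Real.sin (Real.arctan b))]) ((le_abs_self _).trans (h2.trans h3))
  nlinarith [sq_nonneg |a - b|]

lemma circle_null (S : Set ℝ) (hS : volume S = 0) :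
    μH[1] {e : Plane | e ∈ unitCircle ∧ (e 0 = 0 ∨ e 1 / e 0 ∈ S)} = 0 := by
  have hsub : {e : Plane | e ∈ unitCircle ∧ (e 0 = 0 ∨ e 1 / e 0 ∈ S)} ⊆
      (({!₂[0, 1]} : Set Plane) ∪ {!₂[0, -1]}) ∪ (arcpt '' S ∪ (fun a => - arcpt a) '' S) := by
    rintro e ⟨he, h⟩
    have hn : e 0 ^ 2 + e 1 ^ 2 = 1 := by
      have : ‖e‖ = 1 := by simpa [unitCircle] using he
      rw [EuclideanSpace.norm_eq, Real.sqrt_eq_one, Fin.sum_univ_two] at this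
      simpa using this
    by_cases h0 : e 0 = 0
    · left
      rw [h0] at hn
      have : (e 1 - 1) * (e 1 + 1) = 0 := by nlinarith
      rcases mul_eq_zero.1 this with h | h
      · left
        ext i; fin_cases i
        · simpa using h0
        · simp; linarith
      · right
        ext i; fin_cases i
        · simpa using h0
        · simp; linarith
    · right
      have hS' := h.resolve_left h0
      have hsq : 1 + (e 1 / e 0)^2 = (1 / e 0)^2 := by
        field_simp; linarith
      have hc : Real.cos (Real.arctan (e 1 / e 0)) = |e 0| := by
        rw [Real.cos_arctan, hsq, Real.sqrt_sq_eq_abs, abs_div, abs_one, one_div_one_div]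
      have hs : Real.sin (Real.arctan (e 1 / e 0)) = e 1 / e 0 * |e 0| := by
        rw [Real.sin_arctan, hsq, Real.sqrt_sq_eq_abs, abs_div, abs_one, div_div_eq_mul_div, div_one]
      rcases abs_choice (e 0) with h1 | h1
      · left
        refine ⟨_, hS', ?_⟩
        rw [h1] at hc hs
        rw [div_mul_cancel₀ _ h0] at hs
        ext i; fin_cases i
        · simpa [arcpt] using hc
        · simpa [arcpt] using hs
      · right
        refine ⟨_, hS', ?_⟩
        rw [h1] at hc hs
        rw [mul_neg, div_mul_cancel₀ _ h0] at hs
        ext i; fin_cases i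
        · simp [arcpt, hc]
        · simp [arcpt, hs]
  have hv : μH[1] S = 0 := by rw [hausdorffMeasure_real]; exact hS
  have lip2 : LipschitzWith 2 (fun a => - arcpt a) := arcpt_lip.neg
  refine measure_mono_null hsub ?_
  have : NullSingletonClass (μH[1] : Measure Plane) :=
    Measure.nullSingletonClass_hausdorff _ one_pos
  refine measure_union_null (measure_union_null (measure_singleton _) (measure_singleton _))
    (measure_union_null ?_ ?_)
  · refine le_antisymm ((arcpt_lip.hausdorffMeasure_image_le zero_le_one S).trans ?_) zero_le
    rw [hv, mul_zero]
  · refine le_antisymm ((lip2.hausdorffMeasure_image_le zero_le_one S).trans ?_) zero_le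
    rw [hv, mul_zero]

theorem statement11 (K : Set Plane) (t s : ℝ)
    (hK : IsCompact K) (hreg : AhlforsRegular t K)
    (ht0 : 0 < t) (ht2 : t < 2)
    (hs1 : max (t - 1) 0 < s) (hs2 : s ≤ 1) :
    ∃ E : Set Plane, E ⊆ unitCircle ∧ μH[1] E = 0 ∧
      ∀ e ∈ unitCircle \ E,
        dimH {z | z ∈ K ∧ s ≤ upperBoxDim (K ∩ lineThrough e z)}
          ≤ ENNReal.ofReal (max (t - s) 0) := by
  obtain ⟨μ, c, C, hc, hcC, hKc, hμ⟩ := hreg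
  rcases K.subsingleton_or_nontrivial with hsub | hnt
  · refine ⟨∅, empty_subset _, measure_empty, fun e _ => ?_⟩
    rw [Set.Subsingleton.dimH_zero (hsub.anti fun z hz => hz.1)]
    exact zero_le
  have hd : 0 < diam K := by
    obtain ⟨x, hx, y, hy, hxy⟩ := hnt
    exact (dist_pos.2 hxy).trans_le (dist_le_diam_of_mem hK.isBounded hx hy)
  set d := diam K with hdd
  have hC : 0 ≤ C := hc.le.trans hcC
  have huniv : μ univ ≤ ENNReal.ofReal (C * d ^ t) := by
    obtain ⟨x, hx⟩ := hnt.nonempty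
    refine le_trans ?_ (hμ x hx d hd le_rfl).2
    calc μ univ = μ (K ∪ Kᶜ) := by rw [union_compl_self]
      _ ≤ μ K + μ Kᶜ := measure_union_le _ _
      _ = μ K := by rw [hKc, add_zero]
      _ ≤ μ (closedBall x d) := measure_mono fun y hy => by
        rw [mem_closedBall]; exact dist_le_diam_of_mem hK.isBounded hy hx
  have : IsFiniteMeasure μ := ⟨huniv.trans_lt ENNReal.ofReal_lt_top⟩
  have hup : ∀ x ∈ K, ∀ r : ℝ, 0 < r → μ (closedBall x r) ≤ ENNReal.ofReal (C * r ^ t) := by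
    intro x hx r hr
    rcases le_total r d with h | h
    · exact (hμ x hx r hr h).2
    · refine (measure_mono (subset_univ _)).trans (huniv.trans (ENNReal.ofReal_le_ofReal ?_))
      gcongr
  have hlow : ∀ x ∈ K, ∀ r : ℝ, 0 < r → r ≤ d →
      ENNReal.ofReal (c * r ^ t) ≤ μ (closedBall x r) := fun x hx r hr h => (hμ x hx r hr h).1
  obtain ⟨ρ, hρ⟩ := hK.isBounded.exists_norm_le
  set η := s - max (t - 1) 0 with hη
  have hηp : 0 < η := by linarith
  let s' : ℕ → ℝ := fun n => s - η / (n + 2)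
  let u : ℕ → ℝ := fun n => max (t - s' n) 0 + 1 / (n + 1)
  have hup' : ∀ n, 0 < u n := fun n => by
    have : (0:ℝ) < 1 / (n + 1) := by positivity
    have := le_max_right (t - s' n) 0
    simp only [u]; linarith
  have hall : ∀ n m : ℕ, ∀ᵐ a : ℝ, |a| < (m:ℝ) → ∀ e : Plane, e 1 = a * e 0 →
      μH[u n] {z | z ∈ K ∧ s ≤ upperBoxDim (K ∩ lineThrough e z)} = 0 := by
    intro n m
    have h1 : η / ((n:ℝ) + 2) < η := div_lt_self hηp (by have : (0:ℝ) ≤ n := by positivity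
                                                         linarith)
    have h2 : 0 < η / ((n:ℝ) + 2) := by positivity
    have h3 := le_max_right (t-1) 0
    have h4 := le_max_left (t-1) 0
    have h5 : (0:ℝ) < 1 / (n + 1) := by positivity
    refine good_slope (s' := s' n) μ K hKc hC ht2 (by positivity) hc hd (hup' n) ?_ ?_ ?_ ?_ hρ hup hlow
    · have := le_max_left (t - s' n) 0
      simp only [u]; linarith
    · simp only [s']; linarith
    · simp only [s']; linarith
    · simp only [s']; linarith
  have hae : ∀ᵐ a : ℝ, ∀ n m : ℕ, |a| < (m:ℝ) → ∀ e : Plane, e 1 = a * e 0 →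
      μH[u n] {z | z ∈ K ∧ s ≤ upperBoxDim (K ∩ lineThrough e z)} = 0 :=
    ae_all_iff.2 fun n => ae_all_iff.2 fun m => hall n m
  refine ⟨_, fun e he => he.1, circle_null _ (ae_iff.1 hae), ?_⟩
  rintro e ⟨he, hnot⟩
  have hnot' : ¬ (e 0 = 0 ∨ e 1 / e 0 ∈ _) := fun h => hnot ⟨he, h⟩
  rw [not_or] at hnot'
  obtain ⟨h0, hgood⟩ := hnot'
  have hgood' := not_not.1 hgood
  have hbd : ∀ n, dimH {z | z ∈ K ∧ s ≤ upperBoxDim (K ∩ lineThrough e z)}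
      ≤ ENNReal.ofReal (u n) := by
    intro n
    obtain ⟨m, hm⟩ := exists_nat_gt |e 1 / e 0|
    have := hgood' n m hm e (div_mul_cancel₀ _ h0).symm
    apply dimH_le_of_hausdorffMeasure_ne_top
    rw [Real.coe_toNNReal _ (hup' n).le, this]
    exact ENNReal.zero_ne_top
  refine ge_of_tendsto' (x := Filter.atTop) (ENNReal.tendsto_ofReal ?_) hbd
  have l1 : Filter.Tendsto (fun n : ℕ => (1:ℝ) / ((n:ℝ) + 1)) Filter.atTop (nhds 0) :=
    tendsto_one_div_add_atTop_nhds_zero_nat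
  have l2 : Filter.Tendsto (fun n : ℕ => η / ((n:ℝ) + 2)) Filter.atTop (nhds 0) :=
    (Filter.tendsto_atTop_add_const_right _ _ tendsto_natCast_atTop_atTop).const_div_atTop η
  have l3 : Filter.Tendsto (fun n => max (t - s' n) 0) Filter.atTop (nhds (max (t - s) 0)) := by
    have := (tendsto_const_nhds (x := t)).sub ((tendsto_const_nhds (x := s)).sub l2)
    rw [sub_zero] at this
    exact this.max tendsto_const_nhds
  have := l3.add l1
  rw [add_zero] at this
  exact this
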